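/- The double nested sum over pairs of distinct odd positive integers satisfies ∑_{m=1}^{∞} ∑_{k=0}^{m-1} 1/((2k+1)²·(2m+1)²) = (1/4!)·(π/2)⁴, where the outer sum runs over nonnegative integers m and the inner sum over nonnegative integers k < m. -/

import Mathlib

open Real

/-- The second elementary symmetric function of a nonnegative sequence, in terms of the first two
power sums. -/
theorem hasSum_sum_range_mul_of_nonneg {a : ℕ → ℝ} {A B : ℝ} (ha : ∀ n, 0 ≤ a n)
    (hA : HasSum a A) (hB : HasSum (fun n => a n ^ 2) B) :
    HasSum (fun m => ∑ k ∈ Finset.range m, a k * a m) ((A ^ 2 - B) / 2) := by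
  rw [hasSum_iff_tendsto_nat_of_nonneg
    fun m => Finset.sum_nonneg fun k _ => mul_nonneg (ha k) (ha m)]
  refine (((hA.tendsto_sum_nat.pow 2).sub hB.tendsto_sum_nat).div_const 2).congr fun n => ?_
  induction n with
  | zero => simp
  | succ n ih =>
    simp only [Finset.sum_range_succ, ← Finset.sum_mul] at ih ⊢
    linear_combination ih

/-- Removing the even terms from `∑ 1 / n ^ s` multiplies the sum by `1 - 1 / 2 ^ s`. -/
theorem hasSum_one_div_odd_pow {s : ℕ} {Z : ℝ}
    (hZ : HasSum (fun n : ℕ => (1 : ℝ) / (n : ℝ) ^ s) Z) :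
    HasSum (fun n : ℕ => (1 : ℝ) / (2 * (n : ℝ) + 1) ^ s) ((1 - 1 / 2 ^ s) * Z) := by
  have even : HasSum (fun n : ℕ => (1 : ℝ) / ((2 * n : ℕ) : ℝ) ^ s) (1 / 2 ^ s * Z) := by
    have scaled (n : ℕ) : (1 : ℝ) / ((2 * n : ℕ) : ℝ) ^ s = 1 / 2 ^ s * (1 / (n : ℝ) ^ s) := by
      push_cast
      rw [mul_pow, div_mul_div_comm, one_mul]
    simp only [scaled]
    exact hZ.mul_left (1 / 2 ^ s)
  have odd : Summable (fun n : ℕ => (1 : ℝ) / ((2 * n + 1 : ℕ) : ℝ) ^ s) :=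
    hZ.summable.comp_injective (i := fun n : ℕ => 2 * n + 1) fun m n h => by
      simp only at h
      omega
  have total := (HasSum.even_add_odd (f := fun n : ℕ => (1 : ℝ) / (n : ℝ) ^ s)
    even odd.hasSum).unique hZ
  have value : ∑' n : ℕ, (1 : ℝ) / ((2 * n + 1 : ℕ) : ℝ) ^ s = (1 - 1 / 2 ^ s) * Z := by
    linear_combination total
  have sum := odd.hasSum
  rw [value] at sum
  simpa only [Nat.cast_add, Nat.cast_mul, Nat.cast_ofNat, Nat.cast_one] using sum

theorem double_nested_odd_reciprocal_squares_sum :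
    (∑' m : ℕ, ∑ k ∈ Finset.range m,
      (1 : ℝ) / ((2 * (k : ℝ) + 1) ^ 2 * (2 * (m : ℝ) + 1) ^ 2))
      = (1 / (Nat.factorial 4)) * (π / 2) ^ 4 := by
  have squares := hasSum_one_div_odd_pow hasSum_zeta_two
  have fourths := hasSum_one_div_odd_pow hasSum_zeta_four
  have key := hasSum_sum_range_mul_of_nonneg (fun n => by positivity) squares
    (by simpa only [div_pow, one_pow, ← pow_mul] using fourths)
  simp only [div_mul_div_comm, one_mul] at key
  rw [key.tsum_eq]
  norm_num [Nat.factorial]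
  ring
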